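/- For every N ≥ 2 there exists a polyhedron in ℝ^N with fewer than 2N facets and a positive semidefinite quadratic form of rank two whose restriction to that polyhedron has at least 2^{N−2} points of (strict) local maximum attaining pairwise distinct values. -/

import Mathlib

open Matrix

/-- The tent map. -/
noncomputable def tent (a : ℝ) : ℝ := min (2 * a) (2 - 2 * a)

/-- The vertex above the node `a`. -/
noncomputable def vtx (m : ℕ) (a : ℝ) : Fin (m + 1) → ℝ := fun i => tent^[(i : ℕ)] a

/-- The extended formulation of the piecewise linear interpolation of the square. -/
noncomputable def tval (m : ℕ) (x : Fin (m + 1) → ℝ) : ℝ :=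
  x 0 - ∑ i : Fin m, x i.succ / 4 ^ ((i : ℕ) + 1)

lemma tval_succ (m : ℕ) (x : Fin (m + 2) → ℝ) :
    tval (m + 1) x = x 0 - x 1 / 2 + tval m (fun i => x i.succ) / 4 := by
  unfold tval
  rw [Fin.sum_univ_succ]
  have : ∑ i : Fin m, x i.succ.succ / 4 ^ (((i.succ : Fin (m + 1)) : ℕ) + 1)
      = (∑ i : Fin m, x i.succ.succ / 4 ^ ((i : ℕ) + 1)) / 4 := by
    rw [Finset.sum_div]
    refine Finset.sum_congr rfl fun i _ => ?_
    rw [Fin.val_succ, pow_succ _ ((i : ℕ) + 1), div_mul_eq_div_div]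
  rw [this]
  simp
  ring

/-- Feasibility. -/
def Feas (m : ℕ) (x : Fin (m + 1) → ℝ) : Prop :=
  ∀ k : Fin m, x k.succ ≤ 2 * x k.castSucc ∧ x k.succ ≤ 2 - 2 * x k.castSucc

lemma vtx_feas (m : ℕ) (a : ℝ) : Feas m (vtx m a) := by
  intro k
  simp only [vtx, Fin.val_succ, Fin.val_castSucc, Function.iterate_succ_apply']
  exact ⟨min_le_left _ _, min_le_right _ _⟩

lemma vtx_tail (m : ℕ) (a : ℝ) : (fun i : Fin (m + 1) => vtx (m + 1) a i.succ) = vtx m (tent a) := by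
  funext i
  simp [vtx]

lemma key (m : ℕ) : ∀ (j : ℕ), Odd j → j < 2 ^ (m + 1) → ∀ a : ℝ, a * 2 ^ (m + 1) = j →
    tval (m + 1) (vtx (m + 1) a) = a ^ 2 ∧
    ∀ x, Feas (m + 1) x →
      a ^ 2 + 2 * a * (x 0 - a) + |x 0 - a| / 2 ^ (m + 1) ≤ tval (m + 1) x ∧
      (x 0 = a → tval (m + 1) x ≤ a ^ 2 → x = vtx (m + 1) a) := by
  induction m with
  | zero =>
    intro j hj hlt a ha
    have hj1 : j = 1 := by
      rcases hj with ⟨k, rfl⟩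
      norm_num at hlt; omega
    subst hj1
    have ha' : a = 1 / 2 := by norm_num at ha; linarith
    subst ha'
    refine ⟨?_, ?_⟩
    · simp [tval, vtx, tent]; norm_num
    · intro x hx
      have h0 := hx 0
      simp at h0
      have ht : tval (0 + 1) x = x 0 - x 1 / 4 := by simp [tval]
      rw [ht]
      refine ⟨?_, ?_⟩
      · rcases abs_cases (x 0 - 1 / 2) with ⟨h, _⟩ | ⟨h, _⟩ <;> rw [h] <;> norm_num <;> linarith
      · intro h1 h2
        funext i
        fin_cases i
        · simpa [vtx] using h1
        · have : x 1 = 1 := by rw [h1] at h0 h2; norm_num at *; linarith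
          simp [vtx, tent, this]; norm_num
  | succ m ih =>
    intro j hj hlt a ha
    have hp : (0 : ℝ) < 2 ^ (m + 1) := by positivity
    set h : ℝ := 1 / 2 ^ (m + 1 + 1) with hh
    have hhpos : 0 < h := by positivity
    have hh2 : h * (2 ^ (m + 1 + 1)) = 1 := by rw [hh]; field_simp
    have hh3 : (1 : ℝ) / 2 ^ (m + 1) = 2 * h := by rw [hh]; field_simp; ring
    have hdiv : ∀ z : ℝ, z / 2 ^ (m + 1) = z * (2 * h) := by
      intro z; rw [← hh3]; ring
    have hdiv' : ∀ z : ℝ, z / 2 ^ (m + 1 + 1) = z * h := by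
      intro z; rw [hh]; ring
    have haj : a = j * h := by rw [← ha, mul_assoc, mul_comm _ h, hh2, mul_one]
    have hhalf : (2 ^ (m + 1) : ℝ) * h = 1 / 2 := by
      have := hh2; rw [pow_succ] at this; linarith
    have hne : j ≠ 2 ^ (m + 1) := by
      rintro rfl
      rw [pow_succ] at hj
      exact (Nat.not_odd_iff_even.mpr (even_two.mul_left _)) hj
    rcases lt_or_gt_of_ne hne with hlt' | hgt
    · have hb : a + h ≤ 1 / 2 := by
        have h1 : ((j : ℝ) + 1) ≤ 2 ^ (m + 1) := by exact_mod_cast hlt'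
        have := mul_le_mul_of_nonneg_right h1 hhpos.le
        rw [hhalf] at this
        rw [haj]; linarith
      have htent : tent a = 2 * a := by unfold tent; rw [min_eq_left]; linarith
      obtain ⟨i1, i2⟩ := ih j hj hlt' (2 * a) (by rw [← ha]; ring)
      refine ⟨?_, ?_⟩
      · rw [tval_succ, vtx_tail, htent, i1]
        simp [vtx, htent]; ring
      · intro x hx
        have hx0 := hx 0
        have hxt : Feas (m + 1) (fun i => x i.succ) := fun k => hx k.succ
        obtain ⟨j1, j2⟩ := i2 _ hxt
        simp only [Fin.succ_zero_eq_one, Fin.castSucc_zero] at hx0 j1 j2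
        rw [hdiv] at j1
        rw [tval_succ, hdiv']
        have hab : 2 * |x 0 - a| ≤ |x 1 - 2 * a| + (2 * x 0 - x 1) := by
          have e1 := le_abs_self (x 1 - 2 * a)
          have e2 := neg_abs_le (x 1 - 2 * a)
          rcases abs_cases (x 0 - a) with ⟨e, _⟩ | ⟨e, _⟩ <;> rw [e] <;> linarith
        have hab' := mul_le_mul_of_nonneg_right hab hhpos.le
        have hg : 2 * h * (2 * x 0 - x 1) ≤ (1 - 2 * a) * (2 * x 0 - x 1) :=
          mul_le_mul_of_nonneg_right (by linarith) (by linarith)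
        have hn : 0 ≤ h * (2 * x 0 - x 1) := mul_nonneg hhpos.le (by linarith)
        refine ⟨by nlinarith, ?_⟩
        intro h1 h2
        have hz : h * (2 * x 0 - x 1) ≤ 0 := by
          rw [h1, sub_self, abs_zero] at hab'
          rw [h1] at hg hn h2 ⊢
          nlinarith
        have hx1 : x 1 = 2 * a := by
          have : h * (2 * x 0 - x 1) = 0 := le_antisymm hz hn
          rcases mul_eq_zero.mp this with h' | h'
          · exact absurd h' hhpos.ne'
          · linarith
        have hxe := j2 hx1 (by rw [h1, hx1] at h2; linarith)
        funext i
        refine Fin.cases ?_ (fun i => ?_) i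
        · simpa [vtx] using h1
        · rw [congrFun (vtx_tail (m + 1) a) i, htent, ← hxe]
    · have hb : 1 / 2 + h ≤ a := by
        have h1 : ((2 : ℝ) ^ (m + 1) + 1) ≤ j := by exact_mod_cast hgt
        have := mul_le_mul_of_nonneg_right h1 hhpos.le
        rw [add_mul, hhalf] at this
        rw [haj]; linarith
      have htent : tent a = 2 - 2 * a := by unfold tent; rw [min_eq_right]; linarith
      have hodd : Odd (2 ^ (m + 1 + 1) - j) := by
        refine Nat.Even.sub_odd hlt.le ?_ hj
        rw [pow_succ]; exact even_two.mul_left _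
      obtain ⟨i1, i2⟩ := ih (2 ^ (m + 1 + 1) - j) hodd
        (by have : 2 ^ (m + 1 + 1) = 2 * 2 ^ (m + 1) := by ring
            omega) (2 - 2 * a)
        (by rw [Nat.cast_sub hlt.le, ← ha]; push_cast; ring)
      refine ⟨?_, ?_⟩
      · rw [tval_succ, vtx_tail, htent, i1]
        simp [vtx, htent]; ring
      · intro x hx
        have hx0 := hx 0
        have hxt : Feas (m + 1) (fun i => x i.succ) := fun k => hx k.succ
        obtain ⟨j1, j2⟩ := i2 _ hxt
        simp only [Fin.succ_zero_eq_one, Fin.castSucc_zero] at hx0 j1 j2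
        rw [hdiv] at j1
        rw [tval_succ, hdiv']
        have hab : 2 * |x 0 - a| ≤ |x 1 - (2 - 2 * a)| + (2 - 2 * x 0 - x 1) := by
          have e1 := le_abs_self (x 1 - (2 - 2 * a))
          have e2 := neg_abs_le (x 1 - (2 - 2 * a))
          rcases abs_cases (x 0 - a) with ⟨e, _⟩ | ⟨e, _⟩ <;> rw [e] <;> linarith
        have hab' := mul_le_mul_of_nonneg_right hab hhpos.le
        have hg : 2 * h * (2 - 2 * x 0 - x 1) ≤ (2 * a - 1) * (2 - 2 * x 0 - x 1) :=
          mul_le_mul_of_nonneg_right (by linarith) (by linarith)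
        have hn : 0 ≤ h * (2 - 2 * x 0 - x 1) := mul_nonneg hhpos.le (by linarith)
        refine ⟨by nlinarith, ?_⟩
        intro h1 h2
        have hz : h * (2 - 2 * x 0 - x 1) ≤ 0 := by
          rw [h1, sub_self, abs_zero] at hab'
          rw [h1] at hg hn h2 ⊢
          nlinarith
        have hx1 : x 1 = 2 - 2 * a := by
          have : h * (2 - 2 * x 0 - x 1) = 0 := le_antisymm hz hn
          rcases mul_eq_zero.mp this with h' | h'
          · exact absurd h' hhpos.ne'
          · linarith
        have hxe := j2 hx1 (by rw [h1, hx1] at h2; linarith)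
        funext i
        refine Fin.cases ?_ (fun i => ?_) i
        · simpa [vtx] using h1
        · rw [congrFun (vtx_tail (m + 1) a) i, htent, ← hxe]

/-- The planar estimate. -/
lemma planar (d a s t : ℝ) (hd : 2 ≤ d) (ha0 : 0 < a) (ha1 : a < 1)
    (hlow : a ^ 2 + 2 * a * (s - a) + |s - a| / d ≤ t)
    (hs : 4 * d ^ 3 * |s - a| < 1) (ht : |t - a ^ 2| * (1 + 2 * d) < 1)
    (hne : ¬ (s = a ∧ t ≤ a ^ 2)) :
    (2 * d * s) ^ 2 + (t - 2 * d ^ 2) ^ 2 < (2 * d * a) ^ 2 + (a ^ 2 - 2 * d ^ 2) ^ 2 := by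
  have hdpos : 0 < d := by linarith
  obtain ⟨D, hD⟩ : ∃ D, D = t - a ^ 2 - 2 * a * (s - a) := ⟨_, rfl⟩
  obtain ⟨e, he⟩ : ∃ e, e = s - a := ⟨_, rfl⟩
  have hs' : s = a + e := by linarith
  have ht' : t = a ^ 2 + 2 * a * e + D := by rw [hD, he]; ring
  subst hs'
  have hea : a + e - a = e := by ring
  rw [hea] at hlow hs
  have h1 : |e| ≤ d * D := by
    have : |e| / d ≤ D := by linarith
    rw [div_le_iff₀ hdpos] at this; linarith
  have hDpos : 0 < D := by
    have h0 : 0 ≤ D := by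
      have := (abs_nonneg e).trans h1
      exact nonneg_of_mul_nonneg_right this hdpos
    rcases h0.lt_or_eq with h | h
    · exact h
    · exfalso
      rw [← h, mul_zero] at h1
      have : e = 0 := abs_eq_zero.mp (le_antisymm h1 (abs_nonneg e))
      subst this
      exact hne ⟨by ring, by rw [ht', ← h]; simp⟩
  obtain ⟨w, hw⟩ : ∃ w, w = t - a ^ 2 := ⟨_, rfl⟩
  rw [← hw] at ht
  have hwe : w = 2 * a * e + D := by rw [hw, ht']; ring
  have hwb : |w| ≤ (1 + 2 * d) * D := by
    rw [hwe]
    calc |2 * a * e + D| ≤ |2 * a * e| + |D| := abs_add_le _ _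
      _ = 2 * a * |e| + D := by
        rw [abs_mul, abs_of_pos hDpos, abs_of_pos (by positivity : 0 < 2 * a)]
      _ ≤ 2 * 1 * |e| + D := by gcongr
      _ ≤ _ := by linarith
  have q1 : w ^ 2 ≤ D := by
    rw [← sq_abs]
    calc |w| ^ 2 = |w| * |w| := by ring
      _ ≤ |w| * ((1 + 2 * d) * D) := by gcongr
      _ = (|w| * (1 + 2 * d)) * D := by ring
      _ ≤ 1 * D := by gcongr
      _ = D := one_mul D
  have q2 : 4 * d ^ 2 * e ^ 2 ≤ D := by
    rw [← sq_abs e]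
    calc 4 * d ^ 2 * |e| ^ 2 = 4 * d ^ 2 * |e| * |e| := by ring
      _ ≤ 4 * d ^ 2 * |e| * (d * D) := by gcongr
      _ = (4 * d ^ 3 * |e|) * D := by ring
      _ ≤ 1 * D := by gcongr
      _ = D := one_mul D
  have q3 : 4 * a ^ 3 * e ≤ 4 * d * D := by
    calc 4 * a ^ 3 * e ≤ 4 * a ^ 3 * |e| := by gcongr; exact le_abs_self e
      _ ≤ 4 * 1 ^ 3 * |e| := by gcongr
      _ ≤ _ := by linarith
  have q4 : (4 * d + 4) * D ≤ 2 * (2 * d ^ 2 - a ^ 2) * D := by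
    gcongr; nlinarith
  have hfin : (2 * d * (a + e)) ^ 2 + (t - 2 * d ^ 2) ^ 2
      - ((2 * d * a) ^ 2 + (a ^ 2 - 2 * d ^ 2) ^ 2)
      = 4 * a ^ 3 * e + 4 * d ^ 2 * e ^ 2 - 2 * (2 * d ^ 2 - a ^ 2) * D + w ^ 2 := by
    rw [hw, ht']; ring
  linarith

theorem exists_polyhedron_many_local_maxima :
    ∀ N : ℕ, 2 ≤ N →
      ∃ (m : ℕ), m < 2 * N ∧
        ∃ (c : Fin m → (Fin N → ℝ)) (β : Fin m → ℝ)
          (M : Matrix (Fin N) (Fin N) ℝ) (p : Fin (2 ^ (N - 2)) → (Fin N → ℝ)),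
          M.PosSemidef ∧ M.rank = 2 ∧
          (∀ i, ∀ j, c j ⬝ᵥ p i ≤ β j) ∧
          (∀ i, ∃ ε > 0, ∀ x : Fin N → ℝ,
            (∀ j, c j ⬝ᵥ x ≤ β j) → dist x (p i) < ε → x ≠ p i →
              x ⬝ᵥ M.mulVec x < p i ⬝ᵥ M.mulVec (p i)) ∧
          Function.Injective (fun i => p i ⬝ᵥ M.mulVec (p i)) := by
  intro N hN
  obtain ⟨n, rfl⟩ : ∃ n, N = n + 1 + 1 := ⟨N - 2, by omega⟩
  have hN2 : n + 1 + 1 - 2 = n := by omega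
  rw [hN2]
  refine ⟨(n + 1) + (n + 1), by omega, ?_⟩
  obtain ⟨d, hd⟩ : ∃ d : ℝ, d = 2 ^ (n + 1) := ⟨_, rfl⟩
  have hd2 : 2 ≤ d := by
    rw [hd, pow_succ]
    have : (1 : ℝ) ≤ 2 ^ n := one_le_pow₀ (by norm_num)
    linarith
  have hdpos : 0 < d := by linarith
  -- the shift
  let w : Fin (n + 1 + 1) → ℝ := Pi.single 1 (8 * d ^ 2)
  let c : Fin ((n + 1) + (n + 1)) → (Fin (n + 1 + 1) → ℝ) :=
    Fin.addCases (fun k => Pi.single k.succ 1 - Pi.single k.castSucc 2)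
      (fun k => Pi.single k.succ 1 + Pi.single k.castSucc 2)
  let β₀ : Fin ((n + 1) + (n + 1)) → ℝ := Fin.addCases (fun _ => 0) (fun _ => 2)
  have hfeas : ∀ x, (∀ j, c j ⬝ᵥ x ≤ β₀ j) ↔ Feas (n + 1) x := by
    intro x
    rw [Fin.forall_fin_add]
    simp only [c, β₀, Fin.addCases_left, Fin.addCases_right, sub_dotProduct, add_dotProduct,
      single_dotProduct, one_mul, Feas]
    constructor
    · rintro ⟨h1, h2⟩ k
      exact ⟨by linarith [h1 k], by linarith [h2 k]⟩
    · intro h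
      exact ⟨fun k => by linarith [(h k).1], fun k => by linarith [(h k).2]⟩
  let v : Fin (n + 1 + 1) → ℝ := Fin.cons 1 (fun i : Fin (n + 1) => - (1 / 4 ^ ((i : ℕ) + 1)))
  have hv : ∀ x, v ⬝ᵥ x = tval (n + 1) x := by
    intro x
    simp only [dotProduct, v, tval]
    rw [Fin.sum_univ_succ]
    simp only [Fin.cons_zero, Fin.cons_succ, one_mul, sub_eq_add_neg, ← Finset.sum_neg_distrib]
    congr 1
    refine Finset.sum_congr rfl fun i _ => by ring
  let B : Matrix (Fin 2) (Fin (n + 1 + 1)) ℝ := Matrix.of ![Pi.single 0 (2 * d), v]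
  have hq : ∀ x : Fin (n + 1 + 1) → ℝ, x ⬝ᵥ (Bᵀ * B).mulVec x
      = (2 * d * x 0) ^ 2 + (tval (n + 1) x) ^ 2 := by
    intro x
    rw [← mulVec_mulVec, dotProduct_mulVec, vecMul_transpose]
    have e0 : (B *ᵥ x) 0 = 2 * d * x 0 := by simp [B, mulVec]
    have e1 : (B *ᵥ x) 1 = tval (n + 1) x := by rw [← hv]; simp [B, mulVec]
    rw [dotProduct, Fin.sum_univ_two, e0, e1]; ring
  have htw : ∀ x, tval (n + 1) (x + w) = tval (n + 1) x - 2 * d ^ 2 := by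
    intro x
    rw [← hv, ← hv, dotProduct_add]
    have : v ⬝ᵥ w = - (2 * d ^ 2) := by
      have hv1 : v 1 = - (1 / 4) := by
        change v (Fin.succ 0) = _
        simp [v]
      simp only [w, dotProduct_single, hv1]; ring
    rw [this]; ring
  have hw0 : ∀ x : Fin (n + 1 + 1) → ℝ, (x + w) 0 = x 0 := by intro x; simp [w]
  let a : Fin (2 ^ n) → ℝ := fun i => ((2 * (i : ℕ) + 1 : ℕ) : ℝ) / 2 ^ (n + 1)
  have hkey : ∀ i, _ := fun i : Fin (2 ^ n) =>
    key n (2 * (i : ℕ) + 1) ⟨_, rfl⟩ (by have := i.2; rw [pow_succ]; omega) (a i)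
      (by simp only [a]; field_simp)
  have ha0 : ∀ i, 0 < a i := fun i => by positivity
  have ha1 : ∀ i, a i < 1 := fun i => by
    simp only [a]
    rw [div_lt_one (by positivity)]
    have : 2 * (i : ℕ) + 1 < 2 ^ (n + 1) := by have := i.2; rw [pow_succ]; omega
    exact_mod_cast this
  have hqp : ∀ i, (vtx (n + 1) (a i) + w) ⬝ᵥ (Bᵀ * B).mulVec (vtx (n + 1) (a i) + w)
      = (2 * d * a i) ^ 2 + ((a i) ^ 2 - 2 * d ^ 2) ^ 2 := by
    intro i
    rw [hq, htw, hw0, (hkey i).1]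
    simp [vtx]
  refine ⟨c, fun j => β₀ j + c j ⬝ᵥ w, Bᵀ * B, fun i => vtx (n + 1) (a i) + w, ?_, ?_, ?_, ?_, ?_⟩
  · simpa using posSemidef_conjTranspose_mul_self B
  · rw [rank_transpose_mul_self]
    have hli : LinearIndependent ℝ B.row := by
      rw [show B.row = ![B 0, B 1] from by ext i j; fin_cases i <;> rfl]
      have hB0 : B 0 ≠ 0 := by
        intro h
        have := congrFun h 0
        simp [B] at this
        linarith
      rw [LinearIndependent.pair_iff' hB0]
      intro r h
      have := congrFun h 1
      have hv1 : v 1 = - (1 / 4) := by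
        change v (Fin.succ 0) = _
        simp [v]
      simp [B, hv1] at this
    rw [hli.rank_matrix]; simp
  · intro i j
    rw [dotProduct_add]
    have := (hfeas _).2 (vtx_feas (n + 1) (a i)) j
    linarith
  · intro i
    obtain ⟨k1, k2⟩ := hkey i
    have hev : ∀ᶠ x in nhds (vtx (n + 1) (a i) + w),
        4 * d ^ 3 * |x 0 - a i| < 1 ∧
        |(v ⬝ᵥ x + 2 * d ^ 2) - a i ^ 2| * (1 + 2 * d) < 1 := by
      refine Filter.Eventually.and ?_ ?_
      · have hc : Continuous fun x : Fin (n + 1 + 1) → ℝ => 4 * d ^ 3 * |x 0 - a i| := by fun_prop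
        refine (hc.tendsto _).eventually_lt_const ?_
        rw [hw0]; simp [vtx]
      · have hc : Continuous fun x : Fin (n + 1 + 1) → ℝ =>
            |(v ⬝ᵥ x + 2 * d ^ 2) - a i ^ 2| * (1 + 2 * d) := by
          unfold dotProduct; fun_prop
        refine (hc.tendsto _).eventually_lt_const ?_
        rw [hv, htw, k1]; simp
    obtain ⟨ε, hε, hball⟩ := Metric.eventually_nhds_iff.mp hev
    refine ⟨ε, hε, fun x hx hdist hne => ?_⟩
    obtain ⟨b1, b2⟩ := hball hdist
    obtain ⟨y, rfl⟩ : ∃ y, x = y + w := ⟨x - w, by simp⟩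
    rw [hv, htw] at b2
    rw [hw0] at b1
    have hy : Feas (n + 1) y := (hfeas y).1 fun j => by
      have := hx j
      rw [dotProduct_add] at this
      linarith
    obtain ⟨l1, l2⟩ := k2 y hy
    rw [← hd] at l1
    rw [hqp, hq, htw, hw0]
    refine planar d (a i) (y 0) _ hd2 (ha0 i) (ha1 i) l1 b1 ?_ ?_
    · simpa using b2
    · rintro ⟨h1, h2⟩
      exact hne (by rw [l2 h1 h2])
  · intro i j hij
    simp only [hqp] at hij
    have h4 : a i ^ 4 = a j ^ 4 := by linarith
    have h1 : a i = a j := (pow_left_inj₀ (ha0 i).le (ha0 j).le (by norm_num)).1 h4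
    simp only [a] at h1
    rw [div_left_inj' (by positivity)] at h1
    have : 2 * (i : ℕ) + 1 = 2 * (j : ℕ) + 1 := by exact_mod_cast h1
    exact Fin.ext (by omega)
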